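/- Let k and a be integers with 1 ≤ a < k and k − a odd, let q be a complex number with 0 < |q| < 1, and let c be a complex number with c² = q. For each integer n ≥ 0, define β_n = ∑ c^{N_1² + N_2² + ⋯ + N_{k−1}²} q^{N_a + N_{a+2} + ⋯ + N_{k−1}} (−c;q)_{N_{k−1}} / ((−c;q)_n (q;q)_{n−N_1} (q;q)_{N_1−N_2} ⋯ (q;q)_{N_{k−2}−N_{k−1}} (q²;q²)_{N_{k−1}}), where the sum is over all integer tuples with n ≥ N_1 ≥ N_2 ≥ ⋯ ≥ N_{k−1} ≥ 0 and the subscripts a, a+2, …, k−1 increase in steps of 2; and define α_0 = 1 and α_r = (−1)^r c^{(k+1)r²} (c^{(k−a+1)r} + c^{−(k−a+1)r}) for r ≥ 1. Then (α_n, β_n)_{n ≥ 0} is a Bailey pair with parameters (1, q). -/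

import Mathlib

open Finset

/-- Finite q-Pochhammer symbol `(x;q)_n`. -/
noncomputable def qPoch (q x : ℂ) (n : ℕ) : ℂ :=
  ∏ j ∈ Finset.range n, (1 - x * q ^ j)

/-- `(α, β)` is a Bailey pair with parameters `(a, q)` if
`β_n = ∑_{r=0}^n α_r / ((q;q)_{n-r} (aq;q)_{n+r})` for all `n ≥ 0`. -/
def IsBaileyPair (q a : ℂ) (α β : ℕ → ℂ) : Prop :=
  ∀ n : ℕ, β n = ∑ r ∈ Finset.range (n + 1),
    α r / (qPoch q q (n - r) * qPoch q (a * q) (n + r))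

/-- Extend a tuple `N : Fin m → ℕ` (listing `N_1, …, N_m`, 1-based) to `ℕ`, with value
`0` for indices `> m`. -/
def ext (m : ℕ) (N : Fin m → ℕ) (i : ℕ) : ℕ :=
  if h : i - 1 < m then N ⟨i - 1, h⟩ else 0

/-- The sequence `β_n^{(k)}`: a sum over tuples `n ≥ N_1 ≥ ⋯ ≥ N_{k-1} ≥ 0` of
`c^{N_1²+⋯+N_{k-1}²} q^{N_a+N_{a+2}+⋯+N_{k-1}} (-c;q)_{N_{k-1}} /
  ((-c;q)_n (q;q)_{n-N_1} (q;q)_{N_1-N_2} ⋯ (q;q)_{N_{k-2}-N_{k-1}} (q²;q²)_{N_{k-1}})`,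
where `c` is a fixed square root of `q`. -/
noncomputable def betaK (k a : ℕ) (q c : ℂ) (n : ℕ) : ℂ :=
  ∑ N ∈ (Fintype.piFinset fun _ : Fin (k - 1) => Finset.range (n + 1)).filter
      (fun N => ∀ i j : Fin (k - 1), i ≤ j → N j ≤ N i),
    c ^ (∑ i ∈ Finset.Icc 1 (k - 1), (ext (k - 1) N i) ^ 2) *
        q ^ (∑ i ∈ (Finset.Icc a (k - 1)).filter (fun i => i % 2 = a % 2), ext (k - 1) N i) *
        qPoch q (-c) (ext (k - 1) N (k - 1)) /
      (qPoch q (-c) n * qPoch q q (n - ext (k - 1) N 1) *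
        (∏ i ∈ Finset.Icc 1 (k - 2), qPoch q q (ext (k - 1) N i - ext (k - 1) N (i + 1))) *
        qPoch (q ^ 2) (q ^ 2) (ext (k - 1) N (k - 1)))

/-! ### The reciprocal of `(q;q)_m`, extended by zero to negative `m` -/

/-- `1 / (q;q)_m` for an integer `m`, which is `0` for `m < 0`. -/
noncomputable def invPoch (q : ℂ) (m : ℤ) : ℂ :=
  if 0 ≤ m then (qPoch q q m.toNat)⁻¹ else 0

theorem invPoch_natCast (q : ℂ) (m : ℕ) : invPoch q m = (qPoch q q m)⁻¹ := by
  simp [invPoch]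

theorem invPoch_of_neg (q : ℂ) {m : ℤ} (hm : m < 0) : invPoch q m = 0 := by
  simp [invPoch, not_le.mpr hm]

theorem qPoch_zero (q x : ℂ) : qPoch q x 0 = 1 := by simp [qPoch]

theorem qPoch_succ (q x : ℂ) (n : ℕ) :
    qPoch q x (n + 1) = qPoch q x n * (1 - x * q ^ n) := by
  simp [qPoch, Finset.prod_range_succ]

theorem qPoch_succ' (q x : ℂ) (n : ℕ) :
    qPoch q x (n + 1) = (1 - x) * qPoch q (x * q) n := by
  simp only [qPoch, Finset.prod_range_succ', pow_zero, mul_one]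
  rw [mul_comm]
  congr 1
  exact Finset.prod_congr rfl fun j _ => by ring

theorem qPoch_add (q x : ℂ) (m n : ℕ) :
    qPoch q x (m + n) = qPoch q x m * qPoch q (x * q ^ m) n := by
  simp only [qPoch, Finset.prod_range_add]
  congr 1
  exact Finset.prod_congr rfl fun j _ => by ring

theorem one_sub_mul_pow_ne_zero {q x : ℂ} (hq : ‖q‖ < 1) (hx : ‖x‖ < 1) (j : ℕ) :
    1 - x * q ^ j ≠ 0 := by
  intro h
  have h1 : ‖x * q ^ j‖ = 1 := by rw [← sub_eq_zero.mp h]; simp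
  have h2 : ‖x * q ^ j‖ ≤ ‖x‖ := by
    rw [norm_mul, norm_pow]
    exact mul_le_of_le_one_right (norm_nonneg _) (pow_le_one₀ (norm_nonneg _) hq.le)
  linarith

theorem qPoch_ne_zero {q x : ℂ} (hq : ‖q‖ < 1) (hx : ‖x‖ < 1) (n : ℕ) : qPoch q x n ≠ 0 :=
  Finset.prod_ne_zero_iff.mpr fun j _ => one_sub_mul_pow_ne_zero hq hx j

theorem invPoch_sub_one {q : ℂ} (hq : ‖q‖ < 1) (m : ℤ) :
    invPoch q (m - 1) = (1 - q ^ m) * invPoch q m := by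
  rcases lt_trichotomy m 0 with h | rfl | h
  · rw [invPoch_of_neg q h, invPoch_of_neg q (by lia), mul_zero]
  · rw [invPoch_of_neg q (by lia)]; simp
  · obtain ⟨n, rfl⟩ : ∃ n : ℕ, m = (n + 1 : ℕ) := ⟨(m - 1).toNat, by lia⟩
    rw [show ((n + 1 : ℕ) : ℤ) - 1 = n by push_cast; ring, invPoch_natCast, invPoch_natCast,
      qPoch_succ, zpow_natCast]
    have h1 := one_sub_mul_pow_ne_zero hq hq n
    rw [← pow_succ'] at h1 ⊢
    have h2 := qPoch_ne_zero hq hq n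
    field_simp

/-! ### A q-Chu–Vandermonde summation -/

/-- The q-Pascal rule. -/
theorem invPoch_pascal {q : ℂ} (hq0 : q ≠ 0) (hq : ‖q‖ < 1) (m j : ℤ) :
    (1 - q ^ (m + 1)) * (invPoch q j * invPoch q (m + 1 - j)) =
      q ^ j * (invPoch q j * invPoch q (m - j)) + invPoch q (j - 1) * invPoch q (m + 1 - j) := by
  rw [invPoch_sub_one hq j, show m - j = m + 1 - j - 1 by ring, invPoch_sub_one hq (m + 1 - j),
    show q ^ (m + 1) = q ^ j * q ^ (m + 1 - j) by rw [← zpow_add₀ hq0]; congr 1; ring]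
  ring

theorem sum_qChuVandermonde {q : ℂ} (hq0 : q ≠ 0) (hq : ‖q‖ < 1) (m : ℕ) (b z : ℂ)
    (hbz : ∀ j : ℕ, 1 - b * z * q ^ j ≠ 0) :
    ∑ j ∈ range (m + 1), (-1) ^ j * q ^ (j.choose 2) * z ^ j * qPoch q b j / qPoch q (b * z) j *
        (invPoch q j * invPoch q ((m : ℤ) - j)) =
      qPoch q z m / qPoch q (b * z) m * invPoch q m := by
  induction m generalizing z with
  | zero => simp [qPoch_zero, invPoch]
  | succ m ih =>
    have hm : (1 - q ^ ((m : ℤ) + 1)) ≠ 0 := by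
      have := one_sub_mul_pow_ne_zero hq hq m
      rwa [← pow_succ', ← zpow_natCast, Nat.cast_succ] at this
    have hbz' : ∀ j : ℕ, 1 - b * (z * q) * q ^ j ≠ 0 := fun j => by
      have := hbz (j + 1)
      rwa [show b * (z * q) * q ^ j = b * z * q ^ (j + 1) by ring]
    have hP : ∀ j, qPoch q (b * z) j ≠ 0 := fun j =>
      Finset.prod_ne_zero_iff.mpr fun i _ => hbz i
    have hP' : ∀ j, qPoch q (b * (z * q)) j ≠ 0 := fun j =>
      Finset.prod_ne_zero_iff.mpr fun i _ => hbz' i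
    have h0 : 1 - b * z ≠ 0 := by simpa using hbz 0
    apply mul_left_cancel₀ hm
    set t : ℕ → ℂ := fun j =>
      (-1) ^ j * q ^ (j.choose 2) * z ^ j * qPoch q b j / qPoch q (b * z) j with ht
    have split : ∀ j : ℕ, (1 - q ^ ((m : ℤ) + 1)) *
        (t j * (invPoch q j * invPoch q (((m + 1 : ℕ) : ℤ) - j))) =
        t j * q ^ j * (invPoch q j * invPoch q ((m : ℤ) - j)) +
          t j * (invPoch q ((j : ℤ) - 1) * invPoch q ((m : ℤ) + 1 - j)) := fun j => by
      have := invPoch_pascal hq0 hq m j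
      push_cast
      rw [mul_left_comm, this, zpow_natCast]
      ring
    have key : ∀ j : ℕ, t j * q ^ j + t (j + 1) = (1 - z) / (1 - b * z) *
        ((-1) ^ j * q ^ (j.choose 2) * (z * q) ^ j * qPoch q b j / qPoch q (b * (z * q)) j) := by
      intro j
      have e1 : qPoch q (b * (z * q)) j =
          qPoch q (b * z) j * (1 - b * z * q ^ j) / (1 - b * z) := by
        rw [eq_div_iff h0, ← qPoch_succ, qPoch_succ', mul_assoc b z q]
        ring
      have hj := hbz j
      have hPj := hP j
      simp only [ht]
      rw [e1, qPoch_succ, qPoch_succ, Nat.choose_succ_succ' j 1, Nat.choose_one_right, pow_add]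
      field_simp
      ring
    rw [Finset.mul_sum, Finset.sum_congr rfl fun j _ => split j, Finset.sum_add_distrib,
      Finset.sum_range_succ, Finset.sum_range_succ' (fun j : ℕ =>
        t j * (invPoch q ((j : ℤ) - 1) * invPoch q ((m : ℤ) + 1 - j)))]
    rw [invPoch_of_neg q (m := (m : ℤ) - ((m + 1 : ℕ) : ℤ)) (by push_cast; lia),
      invPoch_of_neg q (m := ((0 : ℕ) : ℤ) - 1) (by simp)]
    simp only [mul_zero, zero_mul, add_zero]
    rw [← Finset.sum_add_distrib]
    have h2 := ih (z * q) hbz'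
    calc _ = ∑ j ∈ range (m + 1), (1 - z) / (1 - b * z) *
            ((-1) ^ j * q ^ (j.choose 2) * (z * q) ^ j * qPoch q b j / qPoch q (b * (z * q)) j *
              (invPoch q j * invPoch q ((m : ℤ) - j))) := by
          refine Finset.sum_congr rfl fun j _ => ?_
          rw [← mul_assoc ((1 - z) / _), ← key j]
          push_cast
          rw [show (j : ℤ) + 1 - 1 = j by ring, show (m : ℤ) + 1 - (j + 1) = m - j by ring]
          ring
      _ = _ := by
          rw [← Finset.mul_sum, h2, qPoch_succ' q z, qPoch_succ' q (b * z), mul_assoc b z q]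
          have h3 := invPoch_sub_one hq ((m : ℤ) + 1)
          rw [add_sub_cancel_right] at h3
          rw [h3]
          push_cast
          have := hP' m
          field_simp

/-! ### The Bailey chain step -/

theorem norm_lt_one_of_sq {q c : ℂ} (hq : ‖q‖ < 1) (hc : c ^ 2 = q) : ‖c‖ < 1 := by
  rw [← hc, norm_pow] at hq
  exact (sq_lt_one_iff₀ (norm_nonneg c)).mp hq

theorem sum_chain_kernel_nat {q c : ℂ} (hq0 : q ≠ 0) (hq : ‖q‖ < 1) (hc : c ^ 2 = q)
    (n s : ℕ) (hs : s ≤ n) :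
    ∑ j ∈ range (n + 1), c ^ j ^ 2 * qPoch q (-c) j * invPoch q ((n : ℤ) - j) *
        (invPoch q ((j : ℤ) - s) * invPoch q ((j : ℤ) + s)) =
      qPoch q (-c) n * c ^ s ^ 2 * (invPoch q ((n : ℤ) - s) * invPoch q ((n : ℤ) + s)) := by
  obtain ⟨m, rfl⟩ := Nat.exists_eq_add_of_le hs
  have hzero : ∑ j ∈ range s, c ^ j ^ 2 * qPoch q (-c) j * invPoch q (((s + m : ℕ) : ℤ) - j) *
        (invPoch q ((j : ℤ) - s) * invPoch q ((j : ℤ) + s)) = 0 :=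
    Finset.sum_eq_zero fun j hj => by
      rw [invPoch_of_neg q (m := (j : ℤ) - s) (by have := Finset.mem_range.mp hj; lia)]
      simp
  rw [add_assoc, Finset.sum_range_add, hzero, zero_add]
  have hqs : ‖q ^ (2 * s + 1)‖ < 1 := by
    rw [norm_pow]; exact pow_lt_one₀ (norm_nonneg _) hq (by simp)
  have hbz : -c * q ^ s * (-c * q ^ s) = q ^ (2 * s + 1) := by
    rw [← hc]; ring
  have hcv := sum_qChuVandermonde hq0 hq m (-c * q ^ s) (-c * q ^ s)
    (fun j => by rw [hbz]; exact one_sub_mul_pow_ne_zero hq hqs j)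
  rw [hbz] at hcv
  have h2s : ∀ j : ℕ, invPoch q ((2 * s + j : ℕ) : ℤ) =
      (qPoch q q (2 * s))⁻¹ * (qPoch q (q ^ (2 * s + 1)) j)⁻¹ := fun j => by
    rw [invPoch_natCast, qPoch_add, mul_inv, pow_succ']
  have hexp : ∀ j : ℕ, c ^ (s + j) ^ 2 =
      c ^ s ^ 2 * ((-1) ^ j * q ^ (j.choose 2) * (-c * q ^ s) ^ j) := fun j => by
    have h1 : j ^ 2 = j + 2 * j.choose 2 := by
      rcases j with _ | j
      · rfl
      · rw [Nat.choose_two_right]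
        have h := Nat.div_mul_cancel (Nat.even_mul_pred_self (j + 1)).two_dvd
        simp only [Nat.add_sub_cancel] at h ⊢
        nlinarith
    rw [show (s + j) ^ 2 = s ^ 2 + (2 * (s * j) + j ^ 2) by ring, h1, mul_pow, neg_pow c, ← hc,
      pow_add, pow_add, pow_add]
    have : ((-1 : ℂ) ^ j) * (-1) ^ j = 1 := by rw [← mul_pow]; simp
    rw [← pow_mul, ← pow_mul, ← pow_mul]
    linear_combination (-(c ^ s ^ 2 * c ^ (2 * (s * j)) * c ^ j * c ^ (2 * j.choose 2))) * this
  calc _ = ∑ j ∈ range (m + 1), qPoch q (-c) s * c ^ s ^ 2 * (qPoch q q (2 * s))⁻¹ *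
        ((-1) ^ j * q ^ (j.choose 2) * (-c * q ^ s) ^ j * qPoch q (-c * q ^ s) j /
          qPoch q (q ^ (2 * s + 1)) j * (invPoch q j * invPoch q ((m : ℤ) - j))) := by
        refine Finset.sum_congr rfl fun j _ => ?_
        rw [show ((s + m : ℕ) : ℤ) - ((s + j : ℕ) : ℤ) = m - j by push_cast; ring,
          show ((s + j : ℕ) : ℤ) - s = j by push_cast; ring,
          show ((s + j : ℕ) : ℤ) + s = ((2 * s + j : ℕ) : ℤ) by push_cast; ring,
          h2s, hexp, qPoch_add]
        ring
    _ = _ := by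
        rw [← Finset.mul_sum, hcv, show ((s + m : ℕ) : ℤ) - s = m by push_cast; ring,
          show ((s + m : ℕ) : ℤ) + s = ((2 * s + m : ℕ) : ℤ) by push_cast; ring, h2s, qPoch_add]
        ring

theorem sum_chain_kernel {q c : ℂ} (hq0 : q ≠ 0) (hq : ‖q‖ < 1) (hc : c ^ 2 = q)
    (n : ℕ) (r : ℤ) (hr : r ∈ Icc (-n : ℤ) n) :
    ∑ j ∈ range (n + 1), c ^ j ^ 2 * qPoch q (-c) j * invPoch q ((n : ℤ) - j) *
        (invPoch q ((j : ℤ) - r) * invPoch q ((j : ℤ) + r)) =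
      qPoch q (-c) n * c ^ r.natAbs ^ 2 * (invPoch q ((n : ℤ) - r) * invPoch q ((n : ℤ) + r)) := by
  rw [Finset.mem_Icc] at hr
  have h := sum_chain_kernel_nat hq0 hq hc n r.natAbs (by lia)
  rcases Int.natAbs_eq r with h1 | h1
  · rw [← h1] at h
    exact h
  · rw [show (r.natAbs : ℤ) = -r by lia] at h
    simp only [sub_neg_eq_add, ← sub_eq_add_neg] at h
    simpa only [mul_comm (invPoch q (_ + r))] using h

/-- The bilateral sum `∑ x_r / ((q;q)_{n-r} (q;q)_{n+r})` over all integers `r`. -/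
noncomputable def bilateralSum (q : ℂ) (x : ℤ → ℂ) (n : ℕ) : ℂ :=
  ∑ r ∈ Icc (-n : ℤ) n, x r * (invPoch q ((n : ℤ) - r) * invPoch q ((n : ℤ) + r))

theorem bilateralSum_eq_of_le (q : ℂ) (x : ℤ → ℂ) {j n : ℕ} (h : j ≤ n) :
    bilateralSum q x j =
      ∑ r ∈ Icc (-n : ℤ) n, x r * (invPoch q ((j : ℤ) - r) * invPoch q ((j : ℤ) + r)) := by
  refine Finset.sum_subset (Finset.Icc_subset_Icc (by lia) (by lia)) fun r _ hr => ?_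
  rw [Finset.mem_Icc, not_and_or, not_le, not_le] at hr
  rcases hr with hr | hr
  · rw [invPoch_of_neg q (m := (j : ℤ) + r) (by lia)]; simp
  · rw [invPoch_of_neg q (m := (j : ℤ) - r) (by lia)]; simp

theorem sum_bilateralSum {q c : ℂ} (hq0 : q ≠ 0) (hq : ‖q‖ < 1) (hc : c ^ 2 = q)
    (x : ℤ → ℂ) (n : ℕ) :
    ∑ j ∈ range (n + 1), c ^ j ^ 2 * qPoch q (-c) j * invPoch q ((n : ℤ) - j) *
        bilateralSum q x j =
      qPoch q (-c) n * bilateralSum q (fun r => c ^ r.natAbs ^ 2 * x r) n := by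
  rw [Finset.sum_congr rfl fun j hj => by
    rw [bilateralSum_eq_of_le q x (Nat.lt_succ_iff.mp (Finset.mem_range.mp hj)),
      Finset.mul_sum], Finset.sum_comm, bilateralSum, Finset.mul_sum]
  refine Finset.sum_congr rfl fun r hr => ?_
  have h := sum_chain_kernel hq0 hq hc n r hr
  calc _ = x r * ∑ j ∈ range (n + 1), c ^ j ^ 2 * qPoch q (-c) j * invPoch q ((n : ℤ) - j) *
        (invPoch q ((j : ℤ) - r) * invPoch q ((j : ℤ) + r)) := by
        rw [Finset.mul_sum]
        exact Finset.sum_congr rfl fun j _ => by ring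
    _ = _ := by rw [h]; ring

/-! ### Multiplying `β_n` by `q^n` -/

theorem bilateralSum_antisymm {q : ℂ} (hq : ‖q‖ < 1) (y : ℤ → ℂ)
    (hy : ∀ r, y (-1 - r) = -y r) (n : ℕ) :
    bilateralSum q (fun r => (1 - q ^ ((n : ℤ) - r)) * y r) n = 0 := by
  have h1 : bilateralSum q (fun r => (1 - q ^ ((n : ℤ) - r)) * y r) n =
      ∑ r ∈ Icc (-n : ℤ) (n - 1), y r * (invPoch q ((n : ℤ) - 1 - r) * invPoch q ((n : ℤ) + r)) := by
    rw [bilateralSum]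
    symm
    refine (Finset.sum_congr rfl fun r _ => ?_).trans
      (Finset.sum_subset (Finset.Icc_subset_Icc le_rfl (by lia)) fun r hr hr' => ?_)
    · rw [sub_right_comm, invPoch_sub_one hq]; ring
    · rw [Finset.mem_Icc] at hr hr'
      rw [show r = n by lia]; simp
  rw [h1]
  have h2 : ∑ r ∈ Icc (-n : ℤ) (n - 1),
        y r * (invPoch q ((n : ℤ) - 1 - r) * invPoch q ((n : ℤ) + r)) =
      ∑ r ∈ Icc (-n : ℤ) (n - 1),
        -(y r * (invPoch q ((n : ℤ) - 1 - r) * invPoch q ((n : ℤ) + r))) := by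
    refine Finset.sum_nbij' (fun r => -1 - r) (fun r => -1 - r) ?_ ?_ ?_ ?_ ?_
    · intro r hr; rw [Finset.mem_Icc] at *; lia
    · intro r hr; rw [Finset.mem_Icc] at *; lia
    · intro r _; ring
    · intro r _; ring
    · intro r _
      rw [hy, show (n : ℤ) - 1 - (-1 - r) = n + r by ring,
        show (n : ℤ) + (-1 - r) = n - 1 - r by ring]
      ring
  rw [Finset.sum_neg_distrib] at h2
  exact self_eq_neg.mp h2

theorem pow_mul_bilateralSum {q : ℂ} (hq0 : q ≠ 0) (hq : ‖q‖ < 1) (y : ℤ → ℂ)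
    (hy : ∀ r, y (-1 - r) = -y r) (n : ℕ) :
    q ^ n * bilateralSum q (fun r => q ^ (-r) * y r) n = bilateralSum q y n := by
  have h := bilateralSum_antisymm hq y hy n
  rw [eq_comm, ← sub_eq_zero, ← h]
  simp only [bilateralSum]
  rw [Finset.mul_sum, ← Finset.sum_sub_distrib]
  refine Finset.sum_congr rfl fun r _ => ?_
  rw [sub_eq_add_neg (n : ℤ) r, zpow_add₀ hq0, zpow_natCast]
  ring

theorem bilateralSum_comp_neg (q : ℂ) (x : ℤ → ℂ) (n : ℕ) :
    bilateralSum q (fun r => x (-r)) n = bilateralSum q x n := by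
  refine Finset.sum_nbij' (fun r => -r) (fun r => -r) ?_ ?_ ?_ ?_ ?_
  · intro r hr; rw [Finset.mem_Icc] at *; lia
  · intro r hr; rw [Finset.mem_Icc] at *; lia
  · intro r _; ring
  · intro r _; ring
  · intro r _
    rw [sub_neg_eq_add, ← sub_eq_add_neg, mul_comm (invPoch q (_ + r))]

/-! ### The initial Bailey pair -/

theorem neg_one_zpow_reflect (r : ℤ) : ((-1 : ℂ)) ^ (-1 - r) = -(-1) ^ r := by
  rw [zpow_sub₀ (by norm_num), zpow_neg_one, div_eq_mul_inv, ← inv_zpow]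
  norm_num

theorem bilateralSum_gauss_succ {q : ℂ} (hq0 : q ≠ 0) (hq : ‖q‖ < 1) (n : ℕ) :
    (1 - q ^ (2 * (n + 1))) * bilateralSum q (fun r => (-1) ^ r * q ^ (r ^ 2)) (n + 1) =
      bilateralSum q (fun r => (-1) ^ r * q ^ (r ^ 2)) n := by
  set x : ℤ → ℂ := fun r => (-1) ^ r * q ^ (r ^ 2) with hx
  set y : ℤ → ℂ := fun r => (-1) ^ r * q ^ (r ^ 2 + r) with hy
  have hanti : ∀ r, y (-1 - r) = -y r := fun r => by
    simp only [hy, neg_one_zpow_reflect]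
    rw [show (-1 - r) ^ 2 + (-1 - r) = r ^ 2 + r by ring]
    ring
  have h1 := bilateralSum_antisymm hq y hanti (n + 1)
  have h2 := bilateralSum_comp_neg q
    (fun r => (1 - q ^ (((n + 1 : ℕ) : ℤ) - r)) * y r) (n + 1)
  rw [h1] at h2
  rw [bilateralSum_eq_of_le q x n.le_succ]
  have h3 : q ^ (n + 1) * (bilateralSum q (fun r => (1 - q ^ (((n + 1 : ℕ) : ℤ) - r)) * y r) (n + 1)
      + bilateralSum q (fun r => (1 - q ^ (((n + 1 : ℕ) : ℤ) - -r)) * y (-r)) (n + 1)) = 0 := by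
    rw [h1, h2]; simp
  rw [← sub_eq_zero, ← h3]
  simp only [bilateralSum]
  rw [← Finset.sum_add_distrib, Finset.mul_sum, Finset.mul_sum, ← Finset.sum_sub_distrib]
  refine Finset.sum_congr rfl fun r _ => ?_
  have e1 := invPoch_sub_one hq (((n + 1 : ℕ) : ℤ) - r)
  have e2 := invPoch_sub_one hq (((n + 1 : ℕ) : ℤ) + r)
  rw [show ((n + 1 : ℕ) : ℤ) - r - 1 = n - r by push_cast; ring] at e1
  rw [show ((n + 1 : ℕ) : ℤ) + r - 1 = n + r by push_cast; ring] at e2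
  rw [e1, e2]
  have e3 : ((-1 : ℂ)) ^ (-r) = (-1) ^ r := by rw [zpow_neg, ← inv_zpow]; norm_num
  simp only [hx, hy, e3, neg_sq, sub_neg_eq_add, sub_eq_add_neg (_ : ℤ) r, zpow_add₀ hq0,
    zpow_natCast, zpow_neg]
  have hr : q ^ r ≠ 0 := zpow_ne_zero _ hq0
  field_simp
  ring

theorem bilateralSum_gauss {q : ℂ} (hq0 : q ≠ 0) (hq : ‖q‖ < 1) (n : ℕ) :
    bilateralSum q (fun r => (-1) ^ r * q ^ (r ^ 2)) n = (qPoch (q ^ 2) (q ^ 2) n)⁻¹ := by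
  have hq2 : ‖q ^ 2‖ < 1 := by rw [norm_pow]; exact pow_lt_one₀ (norm_nonneg _) hq (by simp)
  induction n with
  | zero => simp [bilateralSum, invPoch, qPoch_zero]
  | succ n ih =>
    have h := bilateralSum_gauss_succ hq0 hq n
    have h1 := one_sub_mul_pow_ne_zero hq2 hq2 n
    have e : q ^ 2 * (q ^ 2) ^ n = q ^ (2 * (n + 1)) := by ring
    rw [qPoch_succ, mul_inv, ← ih, ← h]
    rw [e] at h1 ⊢
    field_simp

/-! ### Iterating the chain -/

/-- The iterated Bailey sum, by recursion on the number of summation variables; the exponent of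
`q` carried by the `i`-th variable (counting from `0`) is `e i`. -/
noncomputable def chainSum (q c : ℂ) : ℕ → (ℕ → ℕ) → ℕ → ℂ
  | 0, _, n => qPoch q (-c) n / qPoch (q ^ 2) (q ^ 2) n
  | m + 1, e, n => ∑ j ∈ range (n + 1),
      c ^ j ^ 2 * q ^ (e 0 * j) / qPoch q q (n - j) * chainSum q c m (fun i => e (i + 1)) j

/-- The indicator of the positions `a, a + 2, a + 4, …` (counted from `1`) as a function of the
position counted from `0`. -/
def stepIndicator (a i : ℕ) : ℕ := if a ≤ i + 1 ∧ (i + 1) % 2 = a % 2 then 1 else 0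

theorem stepIndicator_one_succ (i : ℕ) : stepIndicator 1 (i + 1) = stepIndicator 2 i := by
  unfold stepIndicator
  congr 1
  apply propext
  lia

theorem stepIndicator_succ_succ (a i : ℕ) :
    stepIndicator (a + 1) (i + 1) = stepIndicator a i := by
  unfold stepIndicator
  congr 1
  apply propext
  lia

theorem chainSum_eq {q c : ℂ} (hq0 : q ≠ 0) (hq : ‖q‖ < 1) (hc : c ^ 2 = q) (m a d : ℕ)
    (ha : 1 ≤ a) (had : m + 2 = a + 2 * d) (n : ℕ) :
    chainSum q c m (stepIndicator a) n = qPoch q (-c) n *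
      bilateralSum q (fun r => (-1) ^ r * c ^ ((m + 2) * r.natAbs ^ 2) * q ^ (d * r)) n := by
  have absorb : ∀ (j : ℕ) (x : ℤ → ℂ) (l : ℕ) (_ : j ∈ range (l + 1)),
      c ^ j ^ 2 / qPoch q q (l - j) * (qPoch q (-c) j * bilateralSum q x j) =
        c ^ j ^ 2 * qPoch q (-c) j * invPoch q ((l : ℤ) - j) * bilateralSum q x j := by
    intro j x l hj
    rw [← Nat.cast_sub (Nat.lt_succ_iff.mp (Finset.mem_range.mp hj)), invPoch_natCast]
    ring
  induction m generalizing a d n with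
  | zero =>
    obtain rfl : d = 0 := by lia
    rw [chainSum, div_eq_mul_inv, ← bilateralSum_gauss hq0 hq]
    congr 2
    funext r
    rw [zero_add, pow_mul, hc, ← zpow_natCast q, Nat.cast_pow, Int.natCast_natAbs, sq_abs]
    simp
  | succ m ih =>
    rw [chainSum]
    obtain rfl | ⟨b, rfl, hb⟩ : a = 1 ∨ ∃ b, a = b + 1 ∧ 1 ≤ b := by
      rcases Nat.eq_or_lt_of_le ha with h | h
      · exact .inl h.symm
      · exact .inr ⟨a - 1, by lia, by lia⟩
    · obtain ⟨f, rfl⟩ : ∃ f, d = f + 1 := ⟨d - 1, by lia⟩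
      have hm : m + 2 = 2 * (f + 1) := by lia
      simp only [stepIndicator_one_succ]
      rw [Finset.sum_congr rfl fun j hj => by
        rw [ih 2 f (by lia) (by lia) j, show stepIndicator 1 0 = 1 by simp [stepIndicator],
          one_mul]]
      set y : ℤ → ℂ := fun r => (-1) ^ r * c ^ ((m + 2) * r.natAbs ^ 2) * q ^ (((f + 1 : ℕ) : ℤ) * r)
        with hy
      have hy2 : ∀ r, y r = (-1) ^ r * q ^ (((f + 1 : ℕ) : ℤ) * (r ^ 2 + r)) := fun r => by
        simp only [hy]
        rw [hm, mul_assoc 2, pow_mul c 2, hc, mul_add, zpow_add₀ hq0, ← mul_assoc,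
          ← zpow_natCast q, Nat.cast_mul, Nat.cast_pow, Int.natCast_natAbs, sq_abs]
      have hanti : ∀ r, y (-1 - r) = -y r := fun r => by
        rw [hy2, hy2, neg_one_zpow_reflect, show (-1 - r) ^ 2 + (-1 - r) = r ^ 2 + r by ring]
        ring
      have hshift : (fun r : ℤ => (-1 : ℂ) ^ r * c ^ ((m + 2) * r.natAbs ^ 2) * q ^ ((f : ℤ) * r)) =
          fun r => q ^ (-r) * y r := by
        funext r
        simp only [hy]
        rw [show ((f : ℤ) * r) = -r + ((f + 1 : ℕ) : ℤ) * r by push_cast; ring, zpow_add₀ hq0]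
        ring
      rw [hshift]
      rw [Finset.sum_congr rfl fun j hj => by
        rw [show c ^ j ^ 2 * q ^ j / qPoch q q (n - j) *
          (qPoch q (-c) j * bilateralSum q (fun r => q ^ (-r) * y r) j) =
          c ^ j ^ 2 / qPoch q q (n - j) *
          (qPoch q (-c) j * (q ^ j * bilateralSum q (fun r => q ^ (-r) * y r) j)) by ring,
          pow_mul_bilateralSum hq0 hq y hanti, absorb j y n hj], sum_bilateralSum hq0 hq hc]
      congr 2
      funext r
      simp only [hy]
      rw [show (m + 1 + 2) * r.natAbs ^ 2 = r.natAbs ^ 2 + (m + 2) * r.natAbs ^ 2 by ring, pow_add]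
      ring
    · simp only [stepIndicator_succ_succ]
      have h0 : stepIndicator (b + 1) 0 = 0 := by
        unfold stepIndicator
        rw [if_neg (by lia)]
      rw [Finset.sum_congr rfl fun j hj => by
        rw [ih b d hb (by lia) j, h0, zero_mul, pow_zero, mul_one, absorb j _ n hj],
        sum_bilateralSum hq0 hq hc]
      congr 2
      funext r
      rw [show (m + 1 + 2) * r.natAbs ^ 2 = r.natAbs ^ 2 + (m + 2) * r.natAbs ^ 2 by ring, pow_add]
      ring

/-! ### Sums over weakly decreasing tuples -/

/-- The weakly decreasing `m`-tuples of naturals at most `n`. -/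
def antitoneTuples (m n : ℕ) : Finset (Fin m → ℕ) :=
  (Fintype.piFinset fun _ : Fin m => Finset.range (n + 1)).filter
    (fun N => ∀ i j : Fin m, i ≤ j → N j ≤ N i)

theorem mem_antitoneTuples {m n : ℕ} {N : Fin m → ℕ} :
    N ∈ antitoneTuples m n ↔ (∀ i, N i ≤ n) ∧ ∀ i j : Fin m, i ≤ j → N j ≤ N i := by
  simp [antitoneTuples]

theorem cons_mem_antitoneTuples {m n j : ℕ} {N : Fin m → ℕ} :
    (Fin.cons j N : Fin (m + 1) → ℕ) ∈ antitoneTuples (m + 1) n ↔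
      j ≤ n ∧ N ∈ antitoneTuples m j := by
  simp only [mem_antitoneTuples, Fin.forall_fin_succ, Fin.cons_zero, Fin.cons_succ]
  constructor
  · rintro ⟨⟨h1, -⟩, ⟨-, h2⟩, h3⟩
    exact ⟨h1, fun i => h2 i (Fin.zero_le _),
      fun i l h => (h3 i).2 l (Fin.succ_le_succ_iff.mpr h)⟩
  · rintro ⟨h1, h2, h3⟩
    refine ⟨⟨h1, fun i => (h2 i).trans h1⟩, ⟨fun _ => le_rfl, fun i _ => h2 i⟩, fun i => ⟨?_, ?_⟩⟩
    · intro h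
      exact absurd h (by simp)
    · intro l h
      exact h3 i l (Fin.succ_le_succ_iff.mp h)

theorem sum_antitoneTuples_succ {M : Type*} [AddCommMonoid M] (m n : ℕ)
    (F : (Fin (m + 1) → ℕ) → M) :
    ∑ N ∈ antitoneTuples (m + 1) n, F N =
      ∑ j ∈ range (n + 1), ∑ N ∈ antitoneTuples m j, F (Fin.cons j N) := by
  rw [Finset.sum_sigma']
  refine Finset.sum_bij' (fun N _ => ⟨N 0, Fin.tail N⟩) (fun p _ => Fin.cons p.1 p.2)
    ?_ ?_ ?_ ?_ ?_
  · intro N hN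
    rw [← Fin.cons_self_tail N, cons_mem_antitoneTuples] at hN
    simpa [Nat.lt_succ_iff] using hN
  · rintro ⟨j, N⟩ h
    rw [cons_mem_antitoneTuples]
    simpa [Nat.lt_succ_iff] using h
  · intro N _
    exact Fin.cons_self_tail N
  · rintro ⟨j, N⟩ _
    simp
  · intro N _
    rw [Fin.cons_self_tail]

/-- The sequence `n, N_1, …, N_m, 0, 0, …`. -/
def extWithTop (m n : ℕ) (N : Fin m → ℕ) (i : ℕ) : ℕ := if i = 0 then n else ext m N i

theorem extWithTop_cons_succ (m n j : ℕ) (N : Fin m → ℕ) (i : ℕ) :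
    extWithTop (m + 1) n (Fin.cons j N) (i + 1) = extWithTop m j N i := by
  rcases i with _ | i
  · simp [extWithTop, _root_.ext]
  · by_cases h : i < m
    · have : (⟨i + 1, by lia⟩ : Fin (m + 1)) = Fin.succ ⟨i, h⟩ := rfl
      simp [extWithTop, _root_.ext, h, this, -Fin.succ_mk]
    · simp [extWithTop, _root_.ext, h]

/-- The summand of the multiple sum, as a function of `M_0 = n, M_1 = N_1, …, M_m = N_m`. -/
noncomputable def chainTerm (q c : ℂ) (m : ℕ) (e M : ℕ → ℕ) : ℂ :=
  c ^ (∑ i ∈ range m, M (i + 1) ^ 2) * q ^ (∑ i ∈ range m, e i * M (i + 1)) * qPoch q (-c) (M m) /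
    ((∏ i ∈ range m, qPoch q q (M i - M (i + 1))) * qPoch (q ^ 2) (q ^ 2) (M m))

theorem chainTerm_succ (q c : ℂ) (m : ℕ) (e M : ℕ → ℕ) :
    chainTerm q c (m + 1) e M = c ^ M 1 ^ 2 * q ^ (e 0 * M 1) / qPoch q q (M 0 - M 1) *
      chainTerm q c m (fun i => e (i + 1)) (fun i => M (i + 1)) := by
  simp only [chainTerm, Finset.sum_range_succ' _ m, Finset.prod_range_succ' _ m, pow_add,
    zero_add, div_eq_mul_inv, mul_inv]
  ring

theorem sum_chainTerm (q c : ℂ) (m : ℕ) (e : ℕ → ℕ) (n : ℕ) :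
    ∑ N ∈ antitoneTuples m n, chainTerm q c m e (extWithTop m n N) = chainSum q c m e n := by
  induction m generalizing e n with
  | zero =>
    have : antitoneTuples 0 n = {default} := by
      ext N
      simp [mem_antitoneTuples, Subsingleton.elim N default]
    simp [this, chainTerm, chainSum, extWithTop]
  | succ m ih =>
    rw [sum_antitoneTuples_succ, chainSum]
    refine Finset.sum_congr rfl fun j _ => ?_
    rw [← ih, Finset.mul_sum]
    refine Finset.sum_congr rfl fun N _ => ?_
    rw [chainTerm_succ]
    simp only [extWithTop_cons_succ]
    rfl

theorem sum_filter_eq_sum_stepIndicator (a m : ℕ) (ha : 1 ≤ a) (f : ℕ → ℕ) :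
    ∑ i ∈ (Icc a m).filter (fun i => i % 2 = a % 2), f i =
      ∑ i ∈ range m, stepIndicator a i * f (i + 1) := by
  have h : (Icc a m).filter (fun i => i % 2 = a % 2) =
      (Ico (0 + 1) (m + 1)).filter (fun i => a ≤ i ∧ i % 2 = a % 2) := by
    ext i
    simp only [Finset.mem_filter, Finset.mem_Icc, Finset.mem_Ico]
    lia
  rw [h, Finset.sum_filter, ← Finset.sum_Ico_add', Finset.range_eq_Ico]
  refine Finset.sum_congr rfl fun i _ => ?_
  simp [stepIndicator]

theorem betaK_eq (m a : ℕ) (ha : 1 ≤ a) (q c : ℂ) (n : ℕ) :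
    betaK (m + 2) a q c n = chainSum q c (m + 1) (stepIndicator a) n / qPoch q (-c) n := by
  rw [← sum_chainTerm, Finset.sum_div, betaK]
  refine Finset.sum_congr rfl fun N _ => ?_
  have hE : ∀ i, extWithTop (m + 1) n N (i + 1) = ext (m + 2 - 1) N (i + 1) := fun i => by
    simp [extWithTop]
  have h0 : extWithTop (m + 1) n N 0 = n := rfl
  have hI : ∀ l : ℕ, Icc 1 l = Ico (0 + 1) (l + 1) := fun l => by ext i; simp
  simp only [show m + 2 - 1 = m + 1 from rfl, show m + 2 - 2 = m from rfl]
  rw [sum_filter_eq_sum_stepIndicator a _ ha, hI, hI, ← Finset.sum_Ico_add',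
    ← Finset.prod_Ico_add', ← Finset.range_eq_Ico, ← Finset.range_eq_Ico, chainTerm,
    Finset.prod_range_succ']
  simp only [hE, h0]
  rw [div_div]
  congr 1
  ring

theorem bilateralSum_eq_sum_range (q : ℂ) (x : ℤ → ℂ) (n : ℕ) :
    bilateralSum q x n = ∑ r ∈ range (n + 1), (if r = 0 then x 0 else x r + x (-r)) /
      (qPoch q q (n - r) * qPoch q q (n + r)) := by
  have split : ∀ (f : ℤ → ℂ) (l : ℕ), ∑ r ∈ Icc (-l : ℤ) l, f r =
      ∑ r ∈ range (l + 1), if r = 0 then f 0 else f r + f (-r) := by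
    intro f l
    induction l with
    | zero => simp
    | succ l ih =>
      have h : Icc (-(l + 1 : ℕ) : ℤ) (l + 1 : ℕ) =
          insert ((l : ℤ) + 1) (insert (-((l : ℤ) + 1)) (Icc (-l : ℤ) l)) := by
        ext r
        simp only [Finset.mem_insert, Finset.mem_Icc]
        lia
      rw [Finset.sum_range_succ, ← ih, h, Finset.sum_insert, Finset.sum_insert]
      · simp; ring
      · simp
      · simp only [Finset.mem_insert, Finset.mem_Icc]
        lia
  rw [bilateralSum, split]
  refine Finset.sum_congr rfl fun r hr => ?_
  have hrn : r ≤ n := Nat.lt_succ_iff.mp (Finset.mem_range.mp hr)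
  rw [sub_neg_eq_add, ← sub_eq_add_neg, ← Nat.cast_sub hrn, ← Nat.cast_add, invPoch_natCast,
    invPoch_natCast]
  split_ifs with h
  · subst h
    simp only [sub_zero, add_zero, invPoch_natCast, Nat.sub_zero, div_eq_mul_inv, mul_inv]
  · rw [div_eq_mul_inv, mul_inv]
    ring

/-- The Bailey pair `(α_n^{(k)}, β_n^{(k)})` with parameters `(1, q)`, where `c² = q`
(so `c^{N²} = q^{N²/2}` and `c^{(k-a+1)r} = q^{(k-a+1)r/2}`). -/
theorem bailey_pair_k (k a : ℕ) (ha : 1 ≤ a) (hak : a < k) (hodd : Odd (k - a))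
    (q c : ℂ) (hq0 : 0 < ‖q‖) (hq1 : ‖q‖ < 1) (hc : c ^ 2 = q) :
    IsBaileyPair q 1
      (fun r => if r = 0 then 1 else
        (-1 : ℂ) ^ r * c ^ ((k + 1) * r ^ 2) *
          (c ^ ((k - a + 1) * r) + c ^ (-(((k - a + 1) * r : ℕ) : ℤ))))
      (betaK k a q c) := by
  intro n
  have hq : q ≠ 0 := norm_pos_iff.mp hq0
  obtain ⟨d, hd⟩ := hodd
  obtain ⟨m, rfl⟩ : ∃ m, k = m + 2 := ⟨k - 2, by lia⟩
  have hc1 : qPoch q (-c) n ≠ 0 :=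
    qPoch_ne_zero hq1 (by rw [norm_neg]; exact norm_lt_one_of_sq hq1 hc) n
  rw [betaK_eq m a ha, chainSum_eq hq hq1 hc (m + 1) a (d + 1) ha (by lia), mul_div_cancel_left₀ _ hc1,
    bilateralSum_eq_sum_range]
  refine Finset.sum_congr rfl fun r _ => ?_
  rw [one_mul]
  congr 1
  beta_reduce
  split_ifs with h
  · simp
  · have e1 : m + 2 - a + 1 = 2 * (d + 1) := by lia
    have e2 : ((-1 : ℂ)) ^ (-(r : ℤ)) = (-1) ^ r := by
      rw [zpow_neg, ← inv_zpow, zpow_natCast]; norm_num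
    rw [e1, e2, Int.natAbs_neg, Int.natAbs_natCast, zpow_natCast, mul_assoc 2, pow_mul c 2, hc,
      Nat.cast_mul, neg_mul_eq_mul_neg, zpow_mul c, mul_neg]
    rw [show (c ^ ((2 : ℕ) : ℤ)) = q by rw [zpow_natCast, hc], ← Nat.cast_mul, zpow_natCast]
    push_cast
    ring
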